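/- arXiv:1712.00102 — 3 statements merged into one kernel-verified Lean document; each statement's English description precedes it below -/
import Mathlib

section
/- Let (Ω, F, P) be a probability space and for every t > 0 let X_t, X̃_t and W_t be real-valued random variables on Ω such that X_t ≤ X̃_t + W_t almost surely for each t. Assume: (i) W_t → 0 in probability as t → ∞; (ii) there is a probability measure μ on ℝ such that the laws of X_t and the laws of X̃_t both converge weakly to μ as t → ∞. Then X_t − X̃_t → 0 in probability, i.e. for every ε > 0, lim_{t→∞} P(|X_t − X̃_t| ≥ ε) = 0. -/
open MeasureTheory Filter

/-- Truncation to `[-M, M]`, as a bounded continuous function. -/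
noncomputable def truncation (M : ℝ) : BoundedContinuousFunction ℝ ℝ :=
  BoundedContinuousFunction.ofNormedAddCommGroup (fun x => max (-M) (min M x))
    (by fun_prop) |M| (by
      intro x
      rw [Real.norm_eq_abs, abs_le]
      constructor
      · exact (neg_le_neg (le_abs_self M)).trans (le_max_left _ _)
      · exact max_le (neg_le_abs M) ((min_le_left _ _).trans (le_abs_self M)))

/-- A bounded continuous function vanishing at `0` and equal to `1` where `R ≤ |x|`. -/
noncomputable def tailCutoff (R : ℝ) : BoundedContinuousFunction ℝ ℝ :=
  BoundedContinuousFunction.ofNormedAddCommGroup (fun x => min 1 |x / R|)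
    (by fun_prop) 1 (by
      intro x
      rw [Real.norm_eq_abs, abs_of_nonneg (le_min zero_le_one (abs_nonneg _))]
      exact min_le_left _ _)

lemma truncation_apply (M x : ℝ) : truncation M x = max (-M) (min M x) := rfl

lemma tailCutoff_apply (R x : ℝ) : tailCutoff R x = min 1 |x / R| := rfl

lemma tailCutoff_nonneg (R x : ℝ) : 0 ≤ tailCutoff R x :=
  le_min zero_le_one (abs_nonneg _)

lemma tailCutoff_eq_one {R x : ℝ} (hR : 0 < R) (h : R ≤ |x|) : tailCutoff R x = 1 := by
  rw [tailCutoff_apply, abs_div, abs_of_pos hR]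
  exact min_eq_left ((one_le_div hR).2 h)

lemma tendsto_integral_tailCutoff (μ : Measure ℝ) [IsFiniteMeasure μ] :
    Tendsto (fun R : ℝ => ∫ x, tailCutoff R x ∂μ) atTop (nhds 0) := by
  rw [← integral_zero ℝ ℝ (μ := μ)]
  refine tendsto_integral_filter_of_dominated_convergence (fun _ => 1)
    (.of_forall fun R => (tailCutoff R).continuous.aestronglyMeasurable)
    (.of_forall fun R => .of_forall fun x => ?_) (integrable_const _)
    (.of_forall fun x => ?_)
  · rw [Real.norm_eq_abs, abs_of_nonneg (tailCutoff_nonneg R x)]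
    exact min_le_left _ _
  · have h : Tendsto (fun R : ℝ => min 1 |x / R|) atTop (nhds (min 1 |0|)) :=
      tendsto_const_nhds.min (tendsto_const_nhds.div_atTop tendsto_id).abs
    simpa [tailCutoff_apply] using h

lemma truncation_sub_le {M x y w : ℝ} (h : x ≤ y + w) :
    truncation M x - truncation M y ≤ |w| := by
  simp only [truncation_apply]
  have hw := le_abs_self w
  have hw0 := abs_nonneg w
  grind

lemma truncation_sub_le_two_mul {M : ℝ} (hM : 0 ≤ M) (x y : ℝ) :
    truncation M x - truncation M y ≤ 2 * M := by
  simp only [truncation_apply]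
  grind

lemma le_abs_truncation_sub {R ε x y : ℝ} (hε : 0 < ε) (hx : |x| < R) (h : ε ≤ |x - y|) :
    ε ≤ |truncation (R + ε) x - truncation (R + ε) y| := by
  simp only [truncation_apply]
  grind

lemma indicator_le_of_le_add {R ε η x y w : ℝ} (hR : 0 < R) (hε : 0 < ε) (hη : 0 < η)
    (h : x ≤ y + w) :
    (if ε ≤ |x - y| then (1 : ℝ) else 0) ≤ tailCutoff R x + ε⁻¹ *
      (2 * η + 4 * (R + ε) * (if η ≤ |w| then 1 else 0)
        + (truncation (R + ε) y - truncation (R + ε) x)) := by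
  have h₁ := truncation_sub_le (M := R + ε) h
  have h₂ := truncation_sub_le_two_mul (M := R + ε) (by positivity) x y
  have key : |truncation (R + ε) x - truncation (R + ε) y| ≤
      2 * η + 4 * (R + ε) * (if η ≤ |w| then 1 else 0)
        + (truncation (R + ε) y - truncation (R + ε) x) := by
    rw [abs_le]
    split_ifs <;> constructor <;> linarith
  have hg := tailCutoff_nonneg R x
  have hd := mul_nonneg (inv_pos.2 hε).le
    (abs_nonneg (truncation (R + ε) x - truncation (R + ε) y))
  refine le_trans ?_ (add_le_add le_rfl (mul_le_mul_of_nonneg_left key (inv_pos.2 hε).le))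
  split_ifs with hxy
  · by_cases hx : |x| < R
    · have hmul := mul_le_mul_of_nonneg_left (le_abs_truncation_sub hε hx hxy)
        (inv_pos.2 hε).le
      rw [inv_mul_cancel₀ hε.ne'] at hmul
      linarith
    · rw [tailCutoff_eq_one hR (not_lt.1 hx)]
      linarith
  · exact add_nonneg hg hd

lemma measureReal_le_abs_sub_le {Ω : Type*} [MeasurableSpace Ω] {P : Measure Ω}
    [IsProbabilityMeasure P] {X Y W : Ω → ℝ} (hX : Measurable X) (hY : Measurable Y)
    (hW : Measurable W) (hle : ∀ᵐ ω ∂P, X ω ≤ Y ω + W ω) {R ε η : ℝ} (hR : 0 < R)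
    (hε : 0 < ε) (hη : 0 < η) :
    P.real {ω | ε ≤ |X ω - Y ω|} ≤ ∫ x, tailCutoff R x ∂(P.map X) + ε⁻¹ *
      (2 * η + 4 * (R + ε) * P.real {ω | η ≤ |W ω|}
        + (∫ x, truncation (R + ε) x ∂(P.map Y) - ∫ x, truncation (R + ε) x ∂(P.map X))) := by
  have int_comp (f : BoundedContinuousFunction ℝ ℝ) {Z : Ω → ℝ} (hZ : Measurable Z) :
      Integrable (fun ω => f (Z ω)) P :=
    have := Measure.isProbabilityMeasure_map hZ.aemeasurable (μ := P)
    (f.integrable (P.map Z)).comp_measurable hZ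
  have int_map (f : BoundedContinuousFunction ℝ ℝ) {Z : Ω → ℝ} (hZ : Measurable Z) :
      ∫ x, f x ∂(P.map Z) = ∫ ω, f (Z ω) ∂P :=
    integral_map hZ.aemeasurable f.continuous.aestronglyMeasurable
  have hA : MeasurableSet {ω | ε ≤ |X ω - Y ω|} :=
    measurableSet_le measurable_const (by fun_prop)
  have hB : MeasurableSet {ω | η ≤ |W ω|} := measurableSet_le measurable_const (by fun_prop)
  have hiA := (integrable_const (μ := P) (1 : ℝ)).indicator hA
  have hiB := (integrable_const (μ := P) (1 : ℝ)).indicator hB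
  have hg := int_comp (tailCutoff R) hX
  have hfX := int_comp (truncation (R + ε)) hX
  have hfY := int_comp (truncation (R + ε)) hY
  have hc := integrable_const (μ := P) (2 * η)
  have hsum := (hc.add (hiB.const_mul (4 * (R + ε)))).add (hfY.sub hfX)
  have hmono := integral_mono_ae hiA (hg.add (hsum.const_mul ε⁻¹)) (by
    filter_upwards [hle] with ω hω
    simpa [Set.indicator_apply] using indicator_le_of_le_add hR hε hη hω)
  rw [int_map _ hX, int_map _ hY, int_map _ hX]
  rw [integral_indicator_const _ hA, integral_add' hg (hsum.const_mul ε⁻¹),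
    integral_const_mul, integral_add' (hc.add (hiB.const_mul _)) (hfY.sub hfX),
    integral_add' hc (hiB.const_mul _), integral_sub' hfY hfX,
    integral_const_mul (4 * (R + ε)), integral_indicator_const _ hB] at hmono
  simpa using hmono

/-- If `X_t ≤ X̃_t + W_t` a.s. for each `t > 0`, `W_t → 0` in
probability, and the laws of `X_t` and of `X̃_t` both converge weakly to the same
probability measure `μ` on `ℝ`, then `X_t − X̃_t → 0` in probability. -/
theorem slow_decorrelation_mechanism
    {Ω : Type*} [MeasurableSpace Ω] (P : Measure Ω) [IsProbabilityMeasure P]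
    (X X' W : ℝ → Ω → ℝ)
    (hX : ∀ t > (0:ℝ), Measurable (X t)) (hX' : ∀ t > (0:ℝ), Measurable (X' t))
    (hW : ∀ t > (0:ℝ), Measurable (W t))
    (hle : ∀ t > (0:ℝ), ∀ᵐ ω ∂P, X t ω ≤ X' t ω + W t ω)
    (hW0 : ∀ ε > (0:ℝ),
      Tendsto (fun t => (P {ω | ε ≤ |W t ω|}).toReal) atTop (nhds 0))
    (μ : Measure ℝ) [IsProbabilityMeasure μ]
    (hXweak : ∀ f : BoundedContinuousFunction ℝ ℝ,
      Tendsto (fun t => ∫ x, f x ∂(P.map (X t))) atTop (nhds (∫ x, f x ∂μ)))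
    (hX'weak : ∀ f : BoundedContinuousFunction ℝ ℝ,
      Tendsto (fun t => ∫ x, f x ∂(P.map (X' t))) atTop (nhds (∫ x, f x ∂μ))) :
    ∀ ε > (0:ℝ),
      Tendsto (fun t => (P {ω | ε ≤ |X t ω - X' t ω|}).toReal) atTop (nhds 0) := by
  intro ε hε
  refine tendsto_order.2 ⟨fun a ha => .of_forall fun t => ha.trans_le ENNReal.toReal_nonneg,
    fun c hc => ?_⟩
  obtain ⟨R, hRc, hR⟩ := (((tendsto_integral_tailCutoff μ).eventually_lt_const
    (half_pos hc)).and (eventually_gt_atTop 0)).exists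
  have hη : 0 < ε * c / 4 := by positivity
  have hlim := (hXweak (tailCutoff R)).add
    ((((hW0 _ hη).const_mul (4 * (R + ε))).const_add (2 * (ε * c / 4)) |>.add
      ((hX'weak (truncation (R + ε))).sub (hXweak (truncation (R + ε))))).const_mul ε⁻¹)
  have hlt : ∫ x, tailCutoff R x ∂μ + ε⁻¹ * (2 * (ε * c / 4) + 4 * (R + ε) * 0 +
      (∫ x, truncation (R + ε) x ∂μ - ∫ x, truncation (R + ε) x ∂μ)) < c := by
    have : ε⁻¹ * (2 * (ε * c / 4)) = c / 2 := by field_simp; norm_num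
    simp only [mul_zero, sub_self, add_zero, this]
    linarith
  filter_upwards [hlim.eventually_lt_const hlt, eventually_gt_atTop 0] with t ht ht0
  exact (measureReal_le_abs_sub_le (hX t ht0) (hX' t ht0) (hW t ht0) (hle t ht0)
    hR hε hη).trans_lt ht
end

section
/- Let (Ω, F, P) be a probability space and for every t > 0 let X_t, Y_t and Z_t be real-valued random variables on Ω with X_t = Y_t + Z_t and Z_t ≥ 0 almost surely for each t. Assume there is a probability measure μ on ℝ such that the laws of X_t and the laws of Y_t both converge weakly to μ as t → ∞. Then Z_t → 0 in probability, i.e. for every ε > 0, lim_{t→∞} P(Z_t ≥ ε) = 0. -/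
open MeasureTheory Filter

/-- The arctangent as a bounded continuous function. -/
noncomputable def arctanBCF : BoundedContinuousFunction ℝ ℝ :=
  .ofNormedAddCommGroup Real.arctan Real.continuous_arctan (Real.pi / 2) fun x => by
    rw [Real.norm_eq_abs, abs_le]
    exact ⟨(Real.neg_pi_div_two_lt_arctan x).le, (Real.arctan_lt_pi_div_two x).le⟩

/-- A continuous cutoff that vanishes on `[-K, K]` and equals `1` outside `(-(K + 1), K + 1)`. -/
noncomputable def outerCutoff (K : ℝ) : BoundedContinuousFunction ℝ ℝ :=
  .ofNormedAddCommGroup (fun x => max 0 (min 1 (|x| - K))) (by fun_prop) 1 fun x => by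
    rw [Real.norm_eq_abs, abs_of_nonneg (le_max_left _ _)]
    exact max_le zero_le_one (min_le_left _ _)

@[simp]
theorem arctanBCF_apply (x : ℝ) : arctanBCF x = Real.arctan x := rfl

theorem outerCutoff_apply (K x : ℝ) : outerCutoff K x = max 0 (min 1 (|x| - K)) := rfl

theorem outerCutoff_nonneg (K x : ℝ) : 0 ≤ outerCutoff K x := le_max_left _ _

theorem outerCutoff_le_one (K x : ℝ) : outerCutoff K x ≤ 1 :=
  max_le zero_le_one (min_le_left _ _)

theorem outerCutoff_eq_zero {K x : ℝ} (h : |x| ≤ K) : outerCutoff K x = 0 :=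
  max_eq_left ((min_le_right _ _).trans (sub_nonpos.2 h))

theorem outerCutoff_eq_one {K x : ℝ} (h : K + 1 ≤ |x|) : outerCutoff K x = 1 := by
  rw [outerCutoff_apply, min_eq_left (by linarith), max_eq_right zero_le_one]

theorem tendsto_integral_outerCutoff (μ : Measure ℝ) [IsFiniteMeasure μ] :
    Tendsto (fun n : ℕ => ∫ x, outerCutoff n x ∂μ) atTop (nhds 0) := by
  rw [← integral_zero ℝ ℝ (μ := μ)]
  refine tendsto_integral_of_dominated_convergence (fun _ => 1)
    (fun n => (outerCutoff n).continuous.aestronglyMeasurable) (integrable_const 1)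
    (fun n => ae_of_all _ fun x => ?_) (ae_of_all _ fun x => ?_)
  · rw [Real.norm_of_nonneg (outerCutoff_nonneg _ x)]
    exact outerCutoff_le_one _ x
  · obtain ⟨N, hN⟩ := exists_nat_ge |x|
    refine tendsto_const_nhds.congr' ?_
    filter_upwards [eventually_ge_atTop N] with n hn
    exact (outerCutoff_eq_zero (hN.trans (Nat.cast_le.2 hn))).symm

/-- On a bounded interval, the arctangent grows by a uniform positive amount over steps of
length `ε`. -/
theorem exists_pos_le_arctan_add_sub_arctan (K : ℝ) {ε : ℝ} (hε : 0 < ε) :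
    ∃ c > 0, ∀ y, |y| ≤ K → c ≤ Real.arctan (y + ε) - Real.arctan y := by
  have hcont : Continuous fun y => Real.arctan (y + ε) - Real.arctan y := by fun_prop
  obtain ⟨c, hc, h⟩ := (isCompact_Icc (a := -K) (b := K)).exists_forall_le'
    hcont.continuousOn (a := 0)
    fun y _ => sub_pos.2 (Real.arctan_strictMono (lt_add_of_pos_right y hε))
  exact ⟨c, hc, fun y hy => h y (abs_le.1 hy)⟩

theorem indicator_le_arctan_sub_div_add_outerCutoff {K ε c x y z : ℝ} (hc : 0 < c)
    (hcK : ∀ y, |y| ≤ K + 1 → c ≤ Real.arctan (y + ε) - Real.arctan y)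
    (hx : x = y + z) (hz : 0 ≤ z) :
    (if ε ≤ z then 1 else 0) ≤ (arctanBCF x - arctanBCF y) / c + outerCutoff K y := by
  have hmono : 0 ≤ (arctanBCF x - arctanBCF y) / c :=
    div_nonneg (sub_nonneg.2 (Real.arctan_mono (by linarith))) hc.le
  have hcut := outerCutoff_nonneg K y
  split_ifs with h
  · rcases le_total |y| (K + 1) with hy | hy
    · have hstep : Real.arctan (y + ε) ≤ Real.arctan x := Real.arctan_mono (by linarith)
      have : 1 ≤ (arctanBCF x - arctanBCF y) / c := by
        rw [one_le_div hc, arctanBCF_apply, arctanBCF_apply]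
        linarith [hcK y hy]
      linarith
    · rw [outerCutoff_eq_one hy]
      linarith
  · linarith

/-- If `X_t = Y_t + Z_t` with `Z_t ≥ 0` a.s. for each `t > 0`, and the
laws of `X_t` and of `Y_t` both converge weakly to the same probability measure `μ`
on `ℝ`, then `Z_t → 0` in probability: `P(Z_t ≥ ε) → 0` for every `ε > 0`. -/
theorem compensator_vanishes_in_probability
    {Ω : Type*} [MeasurableSpace Ω] (P : Measure Ω) [IsProbabilityMeasure P]
    (X Y Z : ℝ → Ω → ℝ)
    (hX : ∀ t > (0:ℝ), Measurable (X t)) (hY : ∀ t > (0:ℝ), Measurable (Y t))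
    (hZ : ∀ t > (0:ℝ), Measurable (Z t))
    (hXYZ : ∀ t > (0:ℝ), ∀ᵐ ω ∂P, X t ω = Y t ω + Z t ω)
    (hZpos : ∀ t > (0:ℝ), ∀ᵐ ω ∂P, 0 ≤ Z t ω)
    (μ : Measure ℝ) [IsProbabilityMeasure μ]
    (hXweak : ∀ f : BoundedContinuousFunction ℝ ℝ,
      Tendsto (fun t => ∫ x, f x ∂(P.map (X t))) atTop (nhds (∫ x, f x ∂μ)))
    (hYweak : ∀ f : BoundedContinuousFunction ℝ ℝ,
      Tendsto (fun t => ∫ x, f x ∂(P.map (Y t))) atTop (nhds (∫ x, f x ∂μ))) :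
    ∀ ε > (0:ℝ),
      Tendsto (fun t => (P {ω | ε ≤ Z t ω}).toReal) atTop (nhds 0) := by
  intro ε hε
  refine Metric.tendsto_nhds.2 fun δ hδ => ?_
  obtain ⟨n, hn⟩ := ((tendsto_integral_outerCutoff μ).eventually (gt_mem_nhds hδ)).exists
  obtain ⟨c, hc, hcK⟩ := exists_pos_le_arctan_add_sub_arctan (n + 1) hε
  have hlim := (((hXweak arctanBCF).sub (hYweak arctanBCF)).div_const c).add
    (hYweak (outerCutoff n))
  rw [sub_self, zero_div, zero_add] at hlim
  filter_upwards [hlim.eventually (gt_mem_nhds hn), eventually_gt_atTop 0] with t ht ht0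
  rw [Real.dist_0_eq_abs, abs_of_nonneg ENNReal.toReal_nonneg]
  refine lt_of_le_of_lt ?_ ht
  have hint {V : Ω → ℝ} (hV : Measurable V) (f : BoundedContinuousFunction ℝ ℝ) :
      Integrable (fun ω => f (V ω)) P :=
    (f.integrable (P.map V)).comp_measurable hV
  have hmap {V : Ω → ℝ} (hV : Measurable V) (f : BoundedContinuousFunction ℝ ℝ) :
      ∫ x, f x ∂(P.map V) = ∫ ω, f (V ω) ∂P :=
    integral_map hV.aemeasurable f.continuous.aestronglyMeasurable
  have hdiff : Integrable (fun ω => (arctanBCF (X t ω) - arctanBCF (Y t ω)) / c) P :=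
    ((hint (hX t ht0) arctanBCF).sub (hint (hY t ht0) arctanBCF)).div_const c
  have hset : MeasurableSet {ω | ε ≤ Z t ω} := measurableSet_le measurable_const (hZ t ht0)
  rw [hmap (hX t ht0), hmap (hY t ht0), hmap (hY t ht0),
    ← integral_sub (hint (hX t ht0) _) (hint (hY t ht0) _), ← integral_div,
    ← integral_add hdiff (hint (hY t ht0) _), ← measureReal_def, ← integral_indicator_one hset]
  refine integral_mono_ae ((integrable_const 1).indicator hset)
    (hdiff.add (hint (hY t ht0) _)) ?_
  filter_upwards [hXYZ t ht0, hZpos t ht0] with ω hω hω0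
  simpa [Set.indicator_apply] using
    indicator_le_arctan_sub_div_add_outerCutoff hc hcK hω hω0
end

section
/- For every real α ∈ (0, 1/2): α − (α/2)·log α + ((1 − α)/2)·log(1 − α) < 1/2 + (α − 1/2)·log 2. -/
/-- By strict AM-GM, `x * (1 - x) < 1 / 4` off `x = 1 / 2`, in logarithmic form. -/
lemma two_mul_log_two_add_log_add_log_one_sub_neg {x : ℝ} (h0 : 0 < x) (h1 : x < 1 / 2) :
    2 * Real.log 2 + Real.log x + Real.log (1 - x) < 0 := by
  have hx : 0 < 1 - x := by linarith
  rw [two_mul, ← Real.log_mul two_ne_zero two_ne_zero, ← Real.log_mul (by norm_num) h0.ne',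
    ← Real.log_mul (by positivity) hx.ne']
  exact Real.log_neg (by positivity) (by nlinarith [mul_pos (sub_pos.2 h1) (sub_pos.2 h1)])

/-- For `α ∈ (0, 1/2)`:
`α − (α/2)·log α + ((1 − α)/2)·log(1 − α) < 1/2 + (α − 1/2)·log 2`,
i.e. `Re f₀(α⁻¹) < Re f₀(2)` for the steepest-descent function `f₀`. -/
theorem Re_f0_inv_alpha_lt_Re_f0_two (α : ℝ) (hα : α ∈ Set.Ioo (0:ℝ) (1/2)) :
    α - (α / 2) * Real.log α + ((1 - α) / 2) * Real.log (1 - α)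
      < 1/2 + (α - 1/2) * Real.log 2 := by
  obtain ⟨h0, h1⟩ := hα
  let F : ℝ → ℝ := fun x ↦
    x - (x / 2) * Real.log x + ((1 - x) / 2) * Real.log (1 - x) - (x - 1/2) * Real.log 2
  have hderiv (x : ℝ) (hx0 : 0 < x) (hx1 : x < 1) :
      HasDerivAt F (-(2 * Real.log 2 + Real.log x + Real.log (1 - x)) / 2) x := by
    have hx : 1 - x ≠ 0 := by linarith
    have hid := hasDerivAt_id' x
    have hsub := hid.const_sub 1
    refine (((hid.sub ((hid.div_const 2).mul (hid.log hx0.ne'))).add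
      ((hsub.div_const 2).mul (hsub.log hx))).sub
      ((hid.sub_const (1/2)).mul_const (Real.log 2))).congr_deriv ?_
    field_simp
    ring
  have hmono : StrictMonoOn F (Set.Icc α (1/2)) := by
    refine strictMonoOn_of_deriv_pos (convex_Icc _ _)
      (fun x hx ↦ (hderiv x (by linarith [hx.1])
        (by linarith [hx.2])).continuousAt.continuousWithinAt) fun x hx ↦ ?_
    rw [interior_Icc] at hx
    have hx0 : 0 < x := h0.trans hx.1
    rw [(hderiv x hx0 (by linarith [hx.2])).deriv]
    linarith [two_mul_log_two_add_log_add_log_one_sub_neg hx0 hx.2]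
  have hlt : F α < F (1/2) :=
    hmono (Set.left_mem_Icc.2 h1.le) (Set.right_mem_Icc.2 h1.le) h1
  have hhalf : F (1/2) = 1/2 := by
    norm_num [F]
  rw [hhalf] at hlt
  exact sub_lt_iff_lt_add.1 hlt
end
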